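/- arXiv:1906.08083 — 2 statements merged into one kernel-verified Lean document; each statement's English description precedes it below -/
import Mathlib

section
/- Let p and q be distinct odd primes with p dividing q − 1, and assume 2^{q−1} ≢ 1 (mod q²). Let A(X) = Σ_{t=0}^{pq²−1} s_t X^t ∈ F₂[X] be the generating polynomial of one period of the binary threshold sequence s. Then the minimal polynomial M_s(X) = (X^{pq²} − 1)/gcd(X^{pq²} − 1, A(X)) of s equals Φ_{pq²}(X) if q ≡ 1 (mod 4), and equals Φ_{pq²}(X)·Φ_{pq}(X) if q ≡ 3 (mod 4), where Φ_n(X) denotes the n-th cyclotomic polynomial over F₂. -/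
/-- Euler quotient modulo `p*q`: for `gcd(t, pq) = 1` it is the unique integer in
`{0, ..., pq-1}` congruent to `(t^((p-1)(q-1)) - 1)/(pq)` modulo `pq`; it is `0` otherwise. -/
def eulerQuotient (p q t : ℕ) : ℕ :=
  if Nat.gcd t (p * q) = 1 then ((t ^ ((p - 1) * (q - 1)) - 1) / (p * q)) % (p * q) else 0

/-- The binary threshold sequence over `F₂`: `s t = 0` if `ψ(t)/(pq) < 1/2`, else `1`. -/
def binSeq (p q t : ℕ) : ZMod 2 :=
  if 2 * eulerQuotient p q t < p * q then 0 else 1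

/-- `D ℓ = { t : 0 ≤ t < pq², gcd(t, pq) = 1, ψ(t) ≡ p·ℓ (mod pq) }`. -/
def Dset (p q ℓ : ℕ) : Finset ℕ :=
  (Finset.range (p * q ^ 2)).filter
    (fun t => Nat.gcd t (p * q) = 1 ∧ eulerQuotient p q t ≡ p * ℓ [MOD p * q])

open Polynomial in
theorem eq_of_associated_zmod_two {f g : (ZMod 2)[X]} (h : Associated f g) : f = g := by
  obtain ⟨u, rfl⟩ := h
  obtain ⟨r, hr, hu⟩ := Polynomial.isUnit_iff.mp u.isUnit
  have key : ∀ r : ZMod 2, r ≠ 0 → r = 1 := by decide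
  rw [← hu, key r hr.ne_zero, C_1, mul_one]

open Polynomial in
/-- If `f` is separable over `F₂` and the factor `M` of `f` vanishes exactly at the roots of `f`
where `A` does not, then `f / gcd f A = M`. -/
theorem div_gcd_eq_of_roots (K : Type) [Field K] [IsAlgClosed K] [Algebra (ZMod 2) K]
    {f A M : (ZMod 2)[X]} (hf : f.Separable) (hM : M ∣ f)
    (h : ∀ β : K, aeval β f = 0 → (aeval β M = 0 ↔ aeval β A ≠ 0)) :
    f / EuclideanDomain.gcd f A = M := by
  obtain ⟨H, hH⟩ := hM
  obtain ⟨k, hk⟩ := EuclideanDomain.gcd_dvd_left f A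
  have hg0 : EuclideanDomain.gcd f A ≠ 0 := by
    intro h0
    rw [h0, zero_mul] at hk
    exact hf.ne_zero hk
  have hMH : IsCoprime M H := (hH ▸ hf).isCoprime
  have hgk : IsCoprime (EuclideanDomain.gcd f A) k := (hk ▸ hf).isCoprime
  have root_gcd : ∀ β : K, aeval β f = 0 → aeval β A = 0 →
      aeval β (EuclideanDomain.gcd f A) = 0 := by
    intro β h1 h2
    rw [EuclideanDomain.gcd_eq_gcd_ab f A, map_add, map_mul, map_mul, h1, h2]
    simp
  have hkH : IsCoprime k H := by
    rw [isCoprime_iff_aeval_ne_zero_of_isAlgClosed (ZMod 2) K] at hMH hgk ⊢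
    intro β
    by_contra! hc
    have hf0 : aeval β f = 0 := by rw [hk, map_mul, hc.1, mul_zero]
    have hA : aeval β A = 0 := by
      by_contra hA
      have := (h β hf0).mpr hA
      exact (hMH β).elim (fun h' => h' this) (fun h' => h' hc.2)
    exact (hgk β).elim (fun h' => h' (root_gcd β hf0 hA)) (fun h' => h' hc.1)
  have hMg : IsCoprime M (EuclideanDomain.gcd f A) := by
    rw [isCoprime_iff_aeval_ne_zero_of_isAlgClosed (ZMod 2) K]
    intro β
    by_contra! hc
    have hf0 : aeval β f = 0 := by rw [hH, map_mul, hc.1, zero_mul]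
    obtain ⟨c, hc'⟩ := EuclideanDomain.gcd_dvd_right f A
    refine (h β hf0).mp hc.1 ?_
    rw [hc', map_mul, hc.2, zero_mul]
  have hkM : k ∣ M := hkH.dvd_of_dvd_mul_right (hH ▸ Dvd.intro_left _ hk.symm)
  have hMk : M ∣ k := hMg.dvd_of_dvd_mul_left (hk ▸ Dvd.intro _ hH.symm)
  have hkM' : k = M := eq_of_associated_zmod_two (associated_of_dvd_dvd hkM hMk)
  rw [← hkM']
  nth_rewrite 1 [hk]
  exact mul_div_cancel_left₀ k hg0

section CharTwoSums

variable {K : Type*} [Field K] [CharP K 2]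

theorem natCast_eq_one_of_odd {n : ℕ} (hn : Odd n) : (n : K) = 1 := by
  obtain ⟨m, rfl⟩ := hn
  push_cast
  rw [CharTwo.two_eq_zero, zero_mul, zero_add]

open Classical in
theorem sum_pow_range_of_pow_eq_one {n : ℕ} (hn : Odd n) {z : K} (hz : z ^ n = 1) :
    ∑ i ∈ Finset.range n, z ^ i = if z = 1 then 1 else 0 := by
  split_ifs with h
  · simp [h, natCast_eq_one_of_odd hn]
  · have := geom_sum_mul z n
    rw [hz, sub_self] at this
    exact (mul_eq_zero.mp this).resolve_right (sub_ne_zero.mpr h)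

open Classical in
theorem sum_pow_range_ne_zero_of_pow_eq_one {n : ℕ} (hn : Odd n) {z : K} (hz : z ^ n = 1) :
    ∑ i ∈ Finset.range n, (if i = 0 then 0 else z ^ i) = if z = 1 then 0 else 1 := by
  have h : ∑ i ∈ Finset.range n, (if i = 0 then 0 else z ^ i) =
      ∑ i ∈ Finset.range n, z ^ i + ∑ i ∈ Finset.range n, (if i = 0 then 1 else 0) := by
    rw [← Finset.sum_add_distrib]
    refine Finset.sum_congr rfl fun i _ => ?_
    split_ifs with hi
    · rw [hi, pow_zero, CharTwo.add_self_eq_zero]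
    · rw [add_zero]
  have h0 : 0 ∈ Finset.range n := Finset.mem_range.mpr hn.pos
  rw [h, sum_pow_range_of_pow_eq_one hn hz, Finset.sum_ite_eq', if_pos h0]
  split_ifs
  · exact CharTwo.add_self_eq_zero 1
  · rw [zero_add]

end CharTwoSums

theorem sum_range_mul_eq {M : Type*} [AddCommMonoid M] (m n : ℕ) (f : ℕ → M) :
    ∑ i ∈ Finset.range (m * n), f i =
      ∑ j ∈ Finset.range m, ∑ r ∈ Finset.range n, f (r + n * j) := by
  induction m with
  | zero => simp
  | succ m ih =>
    rw [Nat.succ_mul, Finset.sum_range_add, ih, Finset.sum_range_succ]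
    congr 1
    refine Finset.sum_congr rfl fun r _ => ?_
    rw [add_comm, mul_comm]

theorem sum_range_mul_of_coprime {M : Type*} [AddCommMonoid M] {m n : ℕ} (h : m.Coprime n)
    (hm : m ≠ 0) (hn : n ≠ 0) (f : ℕ → ℕ → M) :
    ∑ t ∈ Finset.range (m * n), f (t % m) (t % n) =
      ∑ a ∈ Finset.range m, ∑ b ∈ Finset.range n, f a b := by
  rw [← Finset.sum_product']
  refine Finset.sum_nbij' (fun t => (t % m, t % n))
    (fun x => (Nat.chineseRemainder h x.1 x.2 : ℕ)) ?_ ?_ ?_ ?_ ?_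
  · intro t _
    simp [Nat.mod_lt, Nat.pos_of_ne_zero hm, Nat.pos_of_ne_zero hn]
  · intro x _
    exact Finset.mem_range.mpr (Nat.chineseRemainder_lt_mul h _ _ hm hn)
  · intro t ht
    have hu := Nat.chineseRemainder_modEq_unique h (a := t % m) (b := t % n) (z := t)
      (Nat.mod_modEq _ _).symm (Nat.mod_modEq _ _).symm
    have := Nat.mod_eq_of_modEq hu (Nat.chineseRemainder_lt_mul h _ _ hm hn)
    rw [Nat.mod_eq_of_lt (Finset.mem_range.mp ht)] at this
    exact this.symm
  · rintro ⟨a, b⟩ hx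
    simp only [Finset.mem_product, Finset.mem_range] at hx
    ext
    · exact Nat.mod_eq_of_modEq (Nat.chineseRemainder h a b).2.1 hx.1
    · exact Nat.mod_eq_of_modEq (Nat.chineseRemainder h a b).2.2 hx.2
  · intro t _
    rfl

theorem sum_units_zmod {M : Type*} [AddCommMonoid M] (n : ℕ) [NeZero n] (f : ℕ → M) :
    ∑ u : (ZMod n)ˣ, f (u : ZMod n).val =
      ∑ b ∈ Finset.range n, if b.Coprime n then f b else 0 := by
  rw [← Finset.sum_filter]
  refine Finset.sum_bij (fun u _ => (u : ZMod n).val) ?_ ?_ ?_ ?_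
  · intro u _
    exact Finset.mem_filter.mpr
      ⟨Finset.mem_range.mpr (ZMod.val_lt _), ZMod.val_coe_unit_coprime u⟩
  · intro u _ v _ huv
    exact Units.ext (ZMod.val_injective n huv)
  · intro b hb
    simp only [Finset.mem_filter, Finset.mem_range] at hb
    exact ⟨ZMod.unitOfCoprime b hb.2, Finset.mem_univ _, by
      simp [ZMod.val_natCast, Nat.mod_eq_of_lt hb.1]⟩
  · intro u _
    rfl

theorem one_add_mul_pow {q : ℕ} (k n : ℕ) :
    (1 + q * k : ZMod (q ^ 2)) ^ n = 1 + q * ((n * k : ℕ) : ZMod (q ^ 2)) := by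
  have hqq : (q : ZMod (q ^ 2)) * q = 0 := by
    rw [← pow_two, ← Nat.cast_pow, ZMod.natCast_self]
  induction n with
  | zero => simp
  | succ n ih =>
    rw [pow_succ _ n, ih]
    push_cast
    linear_combination (n * k * k : ZMod (q ^ 2)) * hqq

section FermatQuotient

variable {q : ℕ} [hq : Fact q.Prime]

/-- The Fermat quotient `(u ^ (q - 1) - 1) / q` modulo `q` of a unit modulo `q²`. -/
def fermatQuotient (q : ℕ) (u : (ZMod (q ^ 2))ˣ) : ZMod q :=
  (((u : ZMod (q ^ 2)).val ^ (q - 1) - 1) / q : ℕ)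

theorem one_add_mul_eq_iff (k l : ℕ) :
    (1 + q * k : ZMod (q ^ 2)) = 1 + q * l ↔ (k : ZMod q) = l := by
  rw [add_right_inj, ← Nat.cast_mul, ← Nat.cast_mul, ZMod.natCast_eq_natCast_iff,
    ZMod.natCast_eq_natCast_iff, pow_two]
  exact ⟨fun h => Nat.ModEq.mul_left_cancel' hq.out.ne_zero h, fun h => Nat.ModEq.mul_left' q h⟩

theorem pow_sub_one_eq_one_add_mul (u : (ZMod (q ^ 2))ˣ) :
    (u : ZMod (q ^ 2)) ^ (q - 1) =
      1 + q * ((((u : ZMod (q ^ 2)).val ^ (q - 1) - 1) / q : ℕ) : ZMod (q ^ 2)) := by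
  have hco : (u : ZMod (q ^ 2)).val.Coprime q :=
    Nat.Coprime.coprime_dvd_right (dvd_pow_self q two_ne_zero) (ZMod.val_coe_unit_coprime u)
  have h1 : 1 ≡ (u : ZMod (q ^ 2)).val ^ (q - 1) [MOD q] := by
    have := Nat.ModEq.pow_totient hco
    rw [Nat.totient_prime hq.out] at this
    exact this.symm
  have hpos : 1 ≤ (u : ZMod (q ^ 2)).val ^ (q - 1) := by
    refine Nat.one_le_iff_ne_zero.mpr (pow_ne_zero _ ?_)
    intro h0
    rw [h0, Nat.coprime_zero_left] at hco
    exact hq.out.one_lt.ne' hco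
  have h2 := Nat.mul_div_cancel' ((Nat.modEq_iff_dvd' hpos).mp h1)
  rw [← Nat.cast_mul, h2, Nat.cast_sub hpos, Nat.cast_pow, ZMod.natCast_zmod_val]
  simp

theorem fermatQuotient_eq_iff (u : (ZMod (q ^ 2))ˣ) (k : ℕ) :
    fermatQuotient q u = k ↔ (u : ZMod (q ^ 2)) ^ (q - 1) = 1 + q * k := by
  rw [pow_sub_one_eq_one_add_mul u, one_add_mul_eq_iff]
  rfl

theorem pow_sub_one_eq (u : (ZMod (q ^ 2))ˣ) :
    (u : ZMod (q ^ 2)) ^ (q - 1) = 1 + q * ((fermatQuotient q u).val : ZMod (q ^ 2)) :=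
  (fermatQuotient_eq_iff u _).mp (ZMod.natCast_zmod_val _).symm

theorem fermatQuotient_mul (u v : (ZMod (q ^ 2))ˣ) :
    fermatQuotient q (u * v) = fermatQuotient q u + fermatQuotient q v := by
  have hqq : (q : ZMod (q ^ 2)) * q = 0 := by
    rw [← pow_two, ← Nat.cast_pow, ZMod.natCast_self]
  have h : fermatQuotient q (u * v) =
      (((fermatQuotient q u).val + (fermatQuotient q v).val : ℕ) : ZMod q) := by
    rw [fermatQuotient_eq_iff, Units.val_mul, mul_pow, pow_sub_one_eq, pow_sub_one_eq]
    push_cast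
    linear_combination ((fermatQuotient q u).val * (fermatQuotient q v).val : ZMod (q ^ 2)) * hqq
  rw [h]
  simp

theorem fermatQuotient_one : fermatQuotient q 1 = 0 := by
  have := fermatQuotient_mul (q := q) 1 1
  rw [mul_one] at this
  exact left_eq_add.mp this

theorem fermatQuotient_of_val_eq_one_add {u : (ZMod (q ^ 2))ˣ}
    (hu : (u : ZMod (q ^ 2)) = 1 + q) : fermatQuotient q u = -1 := by
  have h : fermatQuotient q u = ((q - 1 : ℕ) : ZMod q) := by
    rw [fermatQuotient_eq_iff, hu]
    simpa using one_add_mul_pow (q := q) 1 (q - 1)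
  rw [h, Nat.cast_sub hq.out.one_le]
  simp

theorem fermatQuotient_ne_zero {t : ℕ} (ht : t.Coprime (q ^ 2))
    (h : ¬ t ^ (q - 1) ≡ 1 [MOD q ^ 2]) : fermatQuotient q (ZMod.unitOfCoprime t ht) ≠ 0 := by
  intro h0
  rw [← Nat.cast_zero, fermatQuotient_eq_iff] at h0
  refine h ((ZMod.natCast_eq_natCast_iff _ _ _).mp ?_)
  simpa using h0

/-- The Euler quotient modulo `pq` is `p` times a multiple of the Fermat quotient. -/
theorem eulerQuotient_eq {p : ℕ} (hp : p.Prime) (hne : p ≠ q) (hdvd : p ∣ q - 1) {t : ℕ}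
    (htp : t.Coprime p) (ht : t.Coprime (q ^ 2)) :
    eulerQuotient p q t =
      p * (((p - 1 : ℕ) : ZMod q) / (p : ZMod q) ^ 2 *
        fermatQuotient q (ZMod.unitOfCoprime t ht)).val := by
  have htq : t.Coprime q := Nat.Coprime.coprime_dvd_right (dvd_pow_self q two_ne_zero) ht
  have hpq : p.Coprime q := (Nat.coprime_primes hp hq.out).mpr hne
  have htpq : t.Coprime (p * q) := htp.mul_right htq
  have ht0 : 1 ≤ t ^ ((p - 1) * (q - 1)) := by
    refine Nat.one_le_iff_ne_zero.mpr (pow_ne_zero _ ?_)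
    rintro rfl
    exact hq.out.one_lt.ne' ((Nat.coprime_zero_left q).mp htq)
  have hpk : t ^ ((p - 1) * (q - 1)) ≡ 1 [MOD p ^ 2] := by
    obtain ⟨a, ha⟩ := hdvd
    have := (Nat.ModEq.pow_totient (htp.pow_right 2)).pow a
    rw [Nat.totient_prime_pow hp two_pos, ← pow_mul, one_pow] at this
    convert this using 2
    rw [ha]
    ring
  have hqk : t ^ ((p - 1) * (q - 1)) ≡ 1 [MOD q] := by
    have := (Nat.ModEq.pow_totient htq).pow (p - 1)
    rwa [Nat.totient_prime hq.out, ← pow_mul, one_pow, mul_comm] at this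
  obtain ⟨k, hk⟩ : p ^ 2 * q ∣ t ^ ((p - 1) * (q - 1)) - 1 :=
    Nat.Coprime.mul_dvd_of_dvd_of_dvd (hpq.pow_left 2)
      ((Nat.modEq_iff_dvd' ht0).mp hpk.symm) ((Nat.modEq_iff_dvd' ht0).mp hqk.symm)
  have hval : (k : ZMod q) = ((p - 1 : ℕ) : ZMod q) / (p : ZMod q) ^ 2 *
        fermatQuotient q (ZMod.unitOfCoprime t ht) := by
    have hp0 : (p : ZMod q) ≠ 0 := by
      rw [Ne, ZMod.natCast_eq_zero_iff]
      exact fun h => hne ((Nat.prime_dvd_prime_iff_eq hq.out hp).mp h).symm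
    have h1 : (t : ZMod (q ^ 2)) ^ ((p - 1) * (q - 1)) =
        1 + q * ((p ^ 2 * k : ℕ) : ZMod (q ^ 2)) := by
      rw [← Nat.cast_pow, ← Nat.sub_add_cancel ht0, hk]
      push_cast
      ring
    rw [mul_comm, pow_mul, ← ZMod.coe_unitOfCoprime t ht, pow_sub_one_eq, one_add_mul_pow,
      one_add_mul_eq_iff] at h1
    push_cast at h1
    rw [ZMod.natCast_zmod_val] at h1
    field_simp
    linear_combination -h1
  rw [← hval, ZMod.val_natCast, eulerQuotient, if_pos htpq, hk,
    show p ^ 2 * q * k = p * q * (p * k) by ring,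
    Nat.mul_div_cancel_left _ (Nat.mul_pos hp.pos hq.out.pos), Nat.mul_mod_mul_left]

end FermatQuotient

theorem exists_unit_eq_one_add (q : ℕ) : ∃ v : (ZMod (q ^ 2))ˣ, (v : ZMod (q ^ 2)) = 1 + q := by
  have hqq : (q : ZMod (q ^ 2)) * q = 0 := by
    rw [← pow_two, ← Nat.cast_pow, ZMod.natCast_self]
  exact ⟨⟨1 + q, 1 - q, by linear_combination -hqq, by linear_combination -hqq⟩, rfl⟩

theorem pow_val_of_val_eq_one_add {q : ℕ} {K : Type*} [Field K] {η : K} (hη : η ^ q ^ 2 = 1) {v : (ZMod (q ^ 2))ˣ}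
    (hv : (v : ZMod (q ^ 2)) = 1 + q) : η ^ (v : ZMod (q ^ 2)).val = η * η ^ q := by
  have : (v : ZMod (q ^ 2)) = ((1 + q : ℕ) : ZMod (q ^ 2)) := by rw [hv]; push_cast; rfl
  rw [this, ZMod.val_natCast, ← pow_eq_pow_mod _ hη, pow_add, pow_one]

section ClassSum

variable {q : ℕ} [hq : Fact q.Prime] {K : Type*} [Field K]

/-- The sum of `η ^ u` over the units `u` modulo `q²` with `L u = x`. -/
def classSum (L : (ZMod (q ^ 2))ˣ → ZMod q) (η : K) (x : ZMod q) : K :=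
  ∑ u : (ZMod (q ^ 2))ˣ, if L u = x then η ^ (u : ZMod (q ^ 2)).val else 0

/-- The indicator function of the upper half of `ZMod q`. -/
def upperHalf (K : Type*) [Field K] (x : ZMod q) : K :=
  if 2 * x.val < q then 0 else 1

theorem classSum_pow_val {L : (ZMod (q ^ 2))ˣ → ZMod q}
    (hL : ∀ u v, L (u * v) = L u + L v) {η : K} (hη : η ^ q ^ 2 = 1) (v : (ZMod (q ^ 2))ˣ)
    (x : ZMod q) :
    classSum L (η ^ (v : ZMod (q ^ 2)).val) x = classSum L η (x + L v) := by
  unfold classSum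
  refine Fintype.sum_equiv (Equiv.mulLeft v) _ _ fun u => ?_
  rw [Equiv.coe_mulLeft, hL, add_comm (L v), Units.val_mul, ZMod.val_mul, ← pow_eq_pow_mod _ hη,
    pow_mul]
  simp only [add_left_inj]

theorem sum_mul_classSum (L : (ZMod (q ^ 2))ˣ → ZMod q) (η : K) (w : ZMod q → K) :
    ∑ x, w x * classSum L η x =
      ∑ u : (ZMod (q ^ 2))ˣ, w (L u) * η ^ (u : ZMod (q ^ 2)).val := by
  simp only [classSum, Finset.mul_sum]
  rw [Finset.sum_comm]
  refine Finset.sum_congr rfl fun u _ => ?_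
  simp

theorem sum_classSum (L : (ZMod (q ^ 2))ˣ → ZMod q) (η : K) :
    ∑ x, classSum L η x = ∑ u : (ZMod (q ^ 2))ˣ, η ^ (u : ZMod (q ^ 2)).val := by
  simpa using sum_mul_classSum L η 1

theorem eq_of_forall_add_eq {M : Type*} {f : ZMod q → M} {d : ZMod q} (hd : d ≠ 0)
    (hf : ∀ x, f (x + d) = f x) (x : ZMod q) : f x = f 0 := by
  have h : ∀ n : ℕ, f (n * d) = f 0 := by
    intro n
    induction n with
    | zero => simp
    | succ n ih => rw [Nat.cast_succ, add_mul, one_mul, hf, ih]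
  have := h (x / d).val
  rwa [ZMod.natCast_zmod_val, div_mul_cancel₀ x hd] at this

theorem sum_upperHalf (hqodd : Odd q) :
    ∑ x : ZMod q, upperHalf K x = (((q - 1) / 2 : ℕ) : K) := by
  obtain ⟨m, rfl⟩ := hqodd
  have h : ∑ x : ZMod (2 * m + 1), upperHalf K x =
      ∑ i ∈ Finset.range (2 * m + 1), if 2 * i < 2 * m + 1 then (0 : K) else 1 :=
    Fin.sum_univ_eq_sum_range (fun i => if 2 * i < 2 * m + 1 then (0 : K) else 1) (2 * m + 1)
  rw [h, show 2 * m + 1 = m + 1 + m by ring, Finset.sum_range_add]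
  rw [Finset.sum_eq_zero, Finset.sum_congr rfl (g := fun _ => (1 : K))]
  · have : (m + 1 + m - 1) / 2 = m := by omega
    simp only [Finset.sum_const, Finset.card_range, nsmul_eq_mul, mul_one, zero_add, this]
  · intro i _
    rw [if_neg (by omega)]
  · intro i hi
    rw [if_pos (by have := Finset.mem_range.mp hi; omega)]

theorem upperHalf_sub (hqodd : Odd q) (x : ZMod q) :
    upperHalf K x - upperHalf K (x - 1) =
      (if x = ((q + 1) / 2 : ℕ) then 1 else 0) - (if x = 0 then 1 else 0) := by
  have h3 : 3 ≤ q := by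
    have := hq.out.two_le
    have := Nat.odd_iff.mp hqodd
    omega
  have hlt := ZMod.val_lt x
  obtain ⟨m, hm⟩ := hqodd
  have hh : x = ((q + 1) / 2 : ℕ) ↔ x.val = (q + 1) / 2 := by
    rw [← (ZMod.val_injective q).eq_iff, ZMod.val_natCast, Nat.mod_eq_of_lt (by omega)]
  unfold upperHalf
  simp only [hh]
  by_cases hx : x = 0
  · subst hx
    have hv : ((0 : ZMod q) - 1).val = q - 1 := by
      obtain ⟨n, rfl⟩ : ∃ n, q = n + 1 := ⟨q - 1, by omega⟩
      rw [zero_sub, ZMod.val_neg_one]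
      rfl
    rw [hv, ZMod.val_zero, if_pos (by omega), if_neg (by omega), if_neg (by omega)]
    simp
  · have hx0 : x.val ≠ 0 := by rwa [Ne, ZMod.val_eq_zero]
    have hv : (x - 1).val = x.val - 1 := by
      have : Fact (1 < q) := ⟨by omega⟩
      rw [ZMod.val_sub (by rw [ZMod.val_one]; omega), ZMod.val_one]
    rw [hv, if_neg hx, sub_zero]
    rcases lt_trichotomy x.val ((q + 1) / 2) with h | h | h
    · rw [if_pos (by omega), if_pos (by omega), if_neg (by omega), sub_zero]
    · rw [if_neg (by omega), if_pos (by omega), if_pos h, sub_zero]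
    · rw [if_neg (by omega), if_neg (by omega), if_neg (by omega), sub_self]

variable [CharP K 2]

open Classical in
theorem sum_units_pow (hqodd : Odd q) {η : K} (hη : η ^ q ^ 2 = 1) :
    ∑ u : (ZMod (q ^ 2))ˣ, η ^ (u : ZMod (q ^ 2)).val =
      if η ^ q = 1 ∧ η ≠ 1 then 1 else 0 := by
  have hqη : (η ^ q) ^ q = 1 := by rw [← pow_mul, ← pow_two, hη]
  have h1 : ∑ u : (ZMod (q ^ 2))ˣ, η ^ (u : ZMod (q ^ 2)).val =
      (∑ j ∈ Finset.range q, (η ^ q) ^ j) *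
        ∑ r ∈ Finset.range q, if r = 0 then 0 else η ^ r := by
    rw [sum_units_zmod (q ^ 2) (fun b => η ^ b), pow_two, sum_range_mul_eq, Finset.sum_mul]
    refine Finset.sum_congr rfl fun j _ => ?_
    rw [Finset.mul_sum]
    refine Finset.sum_congr rfl fun r hr => ?_
    have hco : (r + q * j).Coprime (q * q) ↔ r ≠ 0 := by
      rw [Nat.coprime_mul_iff_right, and_self, Nat.coprime_add_mul_left_left]
      constructor
      · rintro h rfl
        exact hq.out.one_lt.ne' ((Nat.coprime_zero_left q).mp h)
      · exact fun h => (Nat.coprime_of_lt_prime h (Finset.mem_range.mp hr) hq.out).symm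
    simp only [hco]
    split_ifs <;> simp_all
    rw [pow_add, pow_mul, mul_comm]
  rw [h1, sum_pow_range_of_pow_eq_one hqodd hqη]
  by_cases h : η ^ q = 1
  · rw [sum_pow_range_ne_zero_of_pow_eq_one hqodd h]
    by_cases h' : η = 1 <;> simp [h, h']
  · simp [h]

open Classical in
/-- The threshold sum at an element whose order divides `q`. -/
theorem sum_upperHalf_mul_classSum_of_pow_eq_one (hqodd : Odd q) {L : (ZMod (q ^ 2))ˣ → ZMod q}
    (hL : ∀ u v, L (u * v) = L u + L v)
    (hL1 : ∀ v : (ZMod (q ^ 2))ˣ, (v : ZMod (q ^ 2)) = 1 + q → L v ≠ 0)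
    {η : K} (hη : η ^ q = 1) :
    ∑ x, upperHalf K x * classSum L η x =
      if η = 1 then 0 else (((q - 1) / 2 : ℕ) : K) := by
  have hη2 : η ^ q ^ 2 = 1 := by rw [pow_two, pow_mul, hη, one_pow]
  obtain ⟨v, hv⟩ := exists_unit_eq_one_add q
  have hconst : ∀ x, classSum L η x = classSum L η 0 := by
    refine eq_of_forall_add_eq (hL1 v hv) fun x => ?_
    rw [← classSum_pow_val hL hη2, pow_val_of_val_eq_one_add hη2 hv, hη, mul_one]
  have h0 : classSum L η 0 = if η = 1 then 0 else 1 := by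
    have h := sum_classSum L η
    rw [sum_units_pow hqodd hη2, Finset.sum_congr rfl fun x _ => hconst x] at h
    simp only [Finset.sum_const, Finset.card_univ, ZMod.card, nsmul_eq_mul,
      natCast_eq_one_of_odd hqodd, one_mul] at h
    rw [h]
    by_cases h' : η = 1 <;> simp [hη, h']
  simp only [hconst, ← Finset.sum_mul]
  rw [sum_upperHalf hqodd, h0]
  split_ifs <;> simp

/-- The class sums at a primitive `q²`-th root of unity do not all vanish. -/
theorem exists_classSum_ne_zero (hqodd : Odd q) {L : (ZMod (q ^ 2))ˣ → ZMod q}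
    (hL : ∀ u v, L (u * v) = L u + L v)
    (hL1 : ∀ v : (ZMod (q ^ 2))ˣ, (v : ZMod (q ^ 2)) = 1 + q → L v ≠ 0)
    {η : K} (hη : IsPrimitiveRoot η (q ^ 2)) : ∃ x, classSum L η x ≠ 0 := by
  by_contra! hzero
  have hη1 := hη.pow_eq_one
  have hη0 : η ≠ 0 := hη.ne_zero (pow_ne_zero 2 hq.out.ne_zero)
  have hq2 : Odd (q ^ 2) := hqodd.pow
  obtain ⟨v, hv⟩ := exists_unit_eq_one_add q
  have hLone : L 1 = 0 := by
    have := hL 1 1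
    rw [mul_one] at this
    exact left_eq_add.mp this
  have hterm : ∀ j : ℕ, classSum L (η ^ j) 0 * ((η⁻¹) ^ j - ((η * η ^ q)⁻¹) ^ j) = 0 := by
    intro j
    by_cases hj : j.Coprime (q ^ 2)
    · have := classSum_pow_val hL hη1 (ZMod.unitOfCoprime j hj) 0
      rw [ZMod.coe_unitOfCoprime, ZMod.val_natCast, ← pow_eq_pow_mod _ hη1, hzero] at this
      rw [this, zero_mul]
    · rw [Nat.coprime_pow_right_iff two_pos, Nat.coprime_comm, hq.out.coprime_iff_not_dvd,
        not_not] at hj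
      obtain ⟨i, rfl⟩ := hj
      have : (η ^ q) ^ (q * i) = 1 := by
        rw [pow_mul, ← pow_mul η, ← pow_two, hη1, one_pow]
      rw [mul_inv, mul_pow, inv_pow (η ^ q), this, inv_one, mul_one, sub_self, mul_zero]
  have hsum : ∀ c : (ZMod (q ^ 2))ˣ,
      ∑ j ∈ Finset.range (q ^ 2), classSum L (η ^ j) 0 * ((η ^ (c : ZMod (q ^ 2)).val)⁻¹) ^ j =
        if L c = 0 then 1 else 0 := by
    intro c
    simp only [classSum, Finset.sum_mul]
    rw [Finset.sum_comm, Finset.sum_eq_single c]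
    · split_ifs with hc
      · rw [Finset.sum_congr rfl (g := fun _ => (1 : K))]
        · simp only [Finset.sum_const, Finset.card_range, nsmul_eq_mul, mul_one]
          exact natCast_eq_one_of_odd hq2
        · intro j _
          rw [inv_pow, ← pow_mul, ← pow_mul, mul_comm, mul_comm j]
          exact inv_mul_cancel₀ (pow_ne_zero _ hη0)
      · simp
    · intro u _ huc
      split_ifs with hu
      · have hz : (η ^ (u : ZMod (q ^ 2)).val * (η ^ (c : ZMod (q ^ 2)).val)⁻¹) ^ q ^ 2 = 1 := by
          rw [mul_pow, inv_pow, ← pow_mul, ← pow_mul, mul_comm _ (q ^ 2), pow_mul, mul_comm _ (q ^ 2),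
            pow_mul, hη1, one_pow, one_pow, inv_one, mul_one]
        have hz1 : η ^ (u : ZMod (q ^ 2)).val * (η ^ (c : ZMod (q ^ 2)).val)⁻¹ ≠ 1 := by
          intro h
          rw [mul_inv_eq_one₀ (pow_ne_zero _ hη0)] at h
          exact huc (Units.ext (ZMod.val_injective _
            (hη.pow_inj (ZMod.val_lt _) (ZMod.val_lt _) h)))
        have := sum_pow_range_of_pow_eq_one hq2 hz
        rw [if_neg hz1] at this
        rw [← this]
        refine Finset.sum_congr rfl fun j _ => ?_
        rw [mul_pow, ← pow_mul, ← pow_mul, mul_comm j]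
      · simp
    · simp
  have h1 := hsum 1
  have hv' := hsum v
  have hone : η ^ ((1 : (ZMod (q ^ 2))ˣ) : ZMod (q ^ 2)).val = η := by
    have : Fact (1 < q ^ 2) := ⟨Nat.one_lt_pow two_ne_zero hq.out.one_lt⟩
    rw [Units.val_one, ZMod.val_one, pow_one]
  rw [hone, if_pos hLone] at h1
  rw [pow_val_of_val_eq_one_add hη1 hv, if_neg (hL1 v hv)] at hv'
  have := Finset.sum_eq_zero fun j (_ : j ∈ Finset.range (q ^ 2)) => hterm j
  simp only [mul_sub, Finset.sum_sub_distrib] at this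
  rw [h1, hv', sub_zero] at this
  exact one_ne_zero this

/-- The threshold sum does not vanish at primitive `q²`-th roots of unity. -/
theorem sum_upperHalf_mul_classSum_ne_zero (hqodd : Odd q) {L : (ZMod (q ^ 2))ˣ → ZMod q}
    (hL : ∀ u v, L (u * v) = L u + L v)
    (hL1 : ∀ v : (ZMod (q ^ 2))ˣ, (v : ZMod (q ^ 2)) = 1 + q → L v ≠ 0)
    (hL2 : ∀ v : (ZMod (q ^ 2))ˣ, (v : ZMod (q ^ 2)) = 2 → L v ≠ 0)
    {η : K} (hη : IsPrimitiveRoot η (q ^ 2)) :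
    ∑ x, upperHalf K x * classSum L η x ≠ 0 := by
  intro hzero
  have hη1 := hη.pow_eq_one
  have h3 : 3 ≤ q := by
    have := hq.out.two_le
    have := Nat.odd_iff.mp hqodd
    omega
  have hco : Nat.Coprime 2 (q ^ 2) := Nat.Coprime.pow_right 2 hqodd.coprime_two_left
  set v : (ZMod (q ^ 2))ˣ := ZMod.unitOfCoprime 2 hco with hv
  have hv2 : (v : ZMod (q ^ 2)) = 2 := by simp [hv]
  have hη2 : η ^ (v : ZMod (q ^ 2)).val = η ^ 2 := by
    rw [hv, ZMod.coe_unitOfCoprime, ZMod.val_natCast, ← pow_eq_pow_mod _ hη1]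
  have hshift : ∀ y, (∑ x, upperHalf K x * classSum L η (x + y)) ^ 2 =
      ∑ x, upperHalf K x * classSum L η (x + (y + L v)) := by
    intro y
    rw [CharTwo.sum_sq]
    refine Finset.sum_congr rfl fun x _ => ?_
    rw [mul_pow, ← add_assoc, ← classSum_pow_val hL hη1, hη2]
    congr 1
    · unfold upperHalf
      split_ifs <;> simp
    · unfold classSum
      rw [CharTwo.sum_sq]
      refine Finset.sum_congr rfl fun u _ => ?_
      split_ifs
      · rw [← pow_mul, ← pow_mul, mul_comm]
      · simp
  have hall : ∀ y, ∑ x, upperHalf K x * classSum L η (x + y) = 0 := by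
    have hP := eq_of_forall_add_eq (hL2 v hv2)
      (f := fun y => (∑ x, upperHalf K x * classSum L η (x + y)) = 0) (fun y => by
        rw [← hshift, sq_eq_zero_iff])
    intro y
    rw [hP y]
    simpa using hzero
  have hdiff : ∀ y, classSum L η (y + (((q + 1) / 2 : ℕ) : ZMod q)) = classSum L η y := by
    intro y
    have h1 : ∑ x, upperHalf K (x - 1) * classSum L η (x + y) = 0 := by
      rw [← hall (y + 1)]
      refine Fintype.sum_equiv (Equiv.subRight 1) _ _ fun x => ?_
      simp
    have h2 : ∑ x, (upperHalf K x - upperHalf K (x - 1)) * classSum L η (x + y) = 0 := by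
      simp only [sub_mul, Finset.sum_sub_distrib]
      rw [hall, h1, sub_zero]
    simp only [upperHalf_sub hqodd, sub_mul, Finset.sum_sub_distrib, ite_mul, one_mul, zero_mul,
      Finset.sum_ite_eq', Finset.mem_univ, if_true, zero_add] at h2
    rw [add_comm y]
    exact sub_eq_zero.mp h2
  have hhalf : (((q + 1) / 2 : ℕ) : ZMod q) ≠ 0 := by
    rw [Ne, ZMod.natCast_eq_zero_iff]
    intro h
    have := Nat.le_of_dvd (by omega) h
    omega
  have hconst := eq_of_forall_add_eq hhalf hdiff
  have h0 : classSum L η 0 = 0 := by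
    have hqη : η ^ q ≠ 1 :=
      hη.pow_ne_one_of_pos_of_lt hq.out.ne_zero (by nlinarith)
    have h := sum_classSum L η
    rw [sum_units_pow hqodd hη1, Finset.sum_congr rfl fun x _ => hconst x] at h
    simpa [natCast_eq_one_of_odd hqodd, hqη] using h
  obtain ⟨x, hx⟩ := exists_classSum_ne_zero hqodd hL hL1 hη
  exact hx ((hconst x).trans h0)

end ClassSum

section Threshold

variable {p q : ℕ} [hq : Fact q.Prime]

/-- The residue `ψ / p` modulo `q`, where `ψ` is the Euler quotient modulo `pq`, as a function
of the class modulo `q²`. -/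
def reducedQuotient (p q : ℕ) [Fact q.Prime] (u : (ZMod (q ^ 2))ˣ) : ZMod q :=
  ((p - 1 : ℕ) : ZMod q) / (p : ZMod q) ^ 2 * fermatQuotient q u

theorem reducedQuotient_mul (u v : (ZMod (q ^ 2))ˣ) :
    reducedQuotient p q (u * v) = reducedQuotient p q u + reducedQuotient p q v := by
  rw [reducedQuotient, fermatQuotient_mul, mul_add]
  rfl

theorem reducedQuotient_ne_zero (hp : p.Prime) (hdvd : p ∣ q - 1) {u : (ZMod (q ^ 2))ˣ}
    (hu : fermatQuotient q u ≠ 0) : reducedQuotient p q u ≠ 0 := by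
  have hlt : p ≤ q - 1 := Nat.le_of_dvd (Nat.sub_pos_of_lt hq.out.one_lt) hdvd
  have h2 := hp.two_le
  have cast_ne : ∀ m : ℕ, 0 < m → m < q → (m : ZMod q) ≠ 0 := by
    intro m h0 hm h
    exact Nat.not_dvd_of_pos_of_lt h0 hm ((ZMod.natCast_eq_zero_iff _ _).mp h)
  exact mul_ne_zero (div_ne_zero (cast_ne _ (by omega) (by omega))
    (pow_ne_zero 2 (cast_ne _ (by omega) (by omega)))) hu

variable {K : Type*} [Field K] [Algebra (ZMod 2) K]

theorem algebraMap_binSeq_of_coprime (hp : p.Prime) (hne : p ≠ q) (hdvd : p ∣ q - 1) {t : ℕ}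
    (htp : t.Coprime p) (ht : t.Coprime (q ^ 2)) :
    algebraMap (ZMod 2) K (binSeq p q t) =
      upperHalf K (reducedQuotient p q (ZMod.unitOfCoprime t ht)) := by
  rw [binSeq, eulerQuotient_eq hp hne hdvd htp ht, upperHalf, mul_left_comm]
  simp only [Nat.mul_lt_mul_left hp.pos]
  split_ifs with h h' h'
  · exact map_zero _
  · exact absurd h h'
  · exact absurd h' h
  · exact map_one _

theorem binSeq_of_not_coprime (hp : p.Prime) {t : ℕ} (h : ¬ t.Coprime (p * q)) :
    binSeq p q t = 0 := by
  rw [binSeq, eulerQuotient, if_neg h, if_pos]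
  exact Nat.mul_pos hp.pos hq.out.pos

/-- The generating polynomial of the threshold sequence, evaluated at a product of a `p`-th and
a `q²`-th root of unity. -/
theorem sum_binSeq_mul_pow (hp : p.Prime) (hne : p ≠ q) (hdvd : p ∣ q - 1) {ζ η : K}
    (hζ : ζ ^ p = 1) (hη : η ^ q ^ 2 = 1) :
    ∑ t ∈ Finset.range (p * q ^ 2), algebraMap (ZMod 2) K (binSeq p q t) * (ζ * η) ^ t =
      (∑ a ∈ Finset.range p, if a = 0 then 0 else ζ ^ a) *
        ∑ x, upperHalf K x * classSum (reducedQuotient p q) η x := by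
  have hpq : p.Coprime (q ^ 2) := ((Nat.coprime_primes hp hq.out).mpr hne).pow_right 2
  let g : ℕ → K := fun b => if hb : b.Coprime (q ^ 2) then
    upperHalf K (reducedQuotient p q (ZMod.unitOfCoprime b hb)) * η ^ b else 0
  have hg : ∑ x, upperHalf K x * classSum (reducedQuotient p q) η x =
      ∑ b ∈ Finset.range (q ^ 2), g b := by
    have h := sum_units_zmod (q ^ 2) g
    have h' : ∀ b : ℕ, (if b.Coprime (q ^ 2) then g b else 0) = g b := by
      intro b
      split_ifs with hb
      · rfl
      · simp only [g, dif_neg hb]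
    simp only [h'] at h
    rw [← h, sum_mul_classSum]
    refine Finset.sum_congr rfl fun u _ => ?_
    have hu := ZMod.val_coe_unit_coprime u
    have : ZMod.unitOfCoprime (u : ZMod (q ^ 2)).val hu = u := by
      ext
      simp
    simp only [g, dif_pos hu, this]
  rw [hg, Finset.sum_mul_sum, ← sum_range_mul_of_coprime hpq hp.ne_zero
    (pow_ne_zero 2 hq.out.ne_zero) (fun a b => (if a = 0 then 0 else ζ ^ a) * g b)]
  refine Finset.sum_congr rfl fun t _ => ?_
  have hdvdp : t % p = 0 ↔ ¬ t.Coprime p := by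
    rw [Nat.coprime_comm, hp.coprime_iff_not_dvd, not_not, Nat.dvd_iff_mod_eq_zero]
  have hmod : (t % q ^ 2).Coprime (q ^ 2) ↔ t.Coprime (q ^ 2) := by
    rw [Nat.Coprime, Nat.Coprime, ← Nat.gcd_rec, Nat.gcd_comm]
  by_cases htp : t.Coprime p
  · rw [if_neg (fun h => hdvdp.mp h htp)]
    by_cases htq : t.Coprime (q ^ 2)
    · have hu : ZMod.unitOfCoprime (t % q ^ 2) (hmod.mpr htq) = ZMod.unitOfCoprime t htq := by
        ext
        simp
      simp only [g, dif_pos (hmod.mpr htq), hu]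
      rw [algebraMap_binSeq_of_coprime hp hne hdvd htp htq, ← pow_eq_pow_mod _ hζ,
        ← pow_eq_pow_mod _ hη, mul_pow]
      ring
    · have : ¬ t.Coprime (p * q) := fun h =>
        htq (Nat.Coprime.pow_right 2 (Nat.Coprime.coprime_mul_left_right h))
      simp only [g, dif_neg (fun h => htq (hmod.mp h))]
      rw [binSeq_of_not_coprime hp this, map_zero, zero_mul, mul_zero]
  · have : ¬ t.Coprime (p * q) := fun h => htp (Nat.Coprime.coprime_mul_right_right h)
    rw [binSeq_of_not_coprime hp this, if_pos (hdvdp.mpr htp), map_zero, zero_mul, zero_mul]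

end Threshold

theorem exists_mul_eq_of_pow_mul_eq_one {M : Type*} [CommMonoid M] {m n : ℕ} (h : m.Coprime n)
    {β : M} (hβ : β ^ (m * n) = 1) : ∃ ζ η : M, ζ ^ m = 1 ∧ η ^ n = 1 ∧ β = ζ * η := by
  obtain ⟨e, he⟩ := Nat.chineseRemainder h 1 0
  obtain ⟨f, hf⟩ := Nat.chineseRemainder h 0 1
  refine ⟨β ^ e, β ^ f, ?_, ?_, ?_⟩
  · rw [← pow_mul]
    obtain ⟨k, rfl⟩ := (Nat.modEq_zero_iff_dvd).mp he.2
    rw [show n * k * m = m * n * k by ring, pow_mul, hβ, one_pow]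
  · rw [← pow_mul]
    obtain ⟨k, rfl⟩ := (Nat.modEq_zero_iff_dvd).mp hf.1
    rw [show m * k * n = m * n * k by ring, pow_mul, hβ, one_pow]
  · have hef : e + f ≡ 1 [MOD m * n] :=
      (Nat.modEq_and_modEq_iff_modEq_mul h).mp ⟨he.1.add hf.1, he.2.add hf.2⟩
    rw [← pow_add, pow_eq_pow_mod _ hβ, hef, ← pow_eq_pow_mod _ hβ, pow_one]

theorem isPrimitiveRoot_mul_iff_of_prime {M : Type*} [CommMonoid M] {p n d : ℕ} (hp : p.Prime)
    (hpn : p.Coprime n) {ζ η : M} (hζ : ζ ^ p = 1) (hη : η ^ n = 1) :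
    IsPrimitiveRoot (ζ * η) (p * d) ↔ ζ ≠ 1 ∧ IsPrimitiveRoot η d := by
  have hζd := orderOf_dvd_of_pow_eq_one hζ
  have hηd := orderOf_dvd_of_pow_eq_one hη
  have hco : (orderOf ζ).Coprime (orderOf η) := Nat.Coprime.of_dvd hζd hηd hpn
  rw [IsPrimitiveRoot.iff_orderOf, IsPrimitiveRoot.iff_orderOf,
    (Commute.all ζ η).orderOf_mul_eq_mul_orderOf_of_coprime hco, Ne, ← orderOf_eq_one_iff]
  rcases (Nat.dvd_prime hp).mp hζd with h | h
  · rw [h, one_mul]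
    refine ⟨fun h' => absurd ?_ hp.one_lt.ne', fun h' => absurd rfl h'.1⟩
    exact Nat.Coprime.eq_one_of_dvd hpn ((Dvd.intro d h'.symm).trans hηd)
  · rw [h]
    exact ⟨fun h' => ⟨hp.one_lt.ne', Nat.eq_of_mul_eq_mul_left hp.pos h'⟩, fun h' => by rw [h'.2]⟩

open Polynomial in
theorem aeval_cyclotomic_eq_zero_iff {K : Type*} [Field K] [Algebra (ZMod 2) K] [CharP K 2]
    {n : ℕ} (hn : Odd n) (β : K) :
    aeval β (cyclotomic n (ZMod 2)) = 0 ↔ IsPrimitiveRoot β n := by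
  have : NeZero (n : K) := ⟨by rw [natCast_eq_one_of_odd hn]; exact one_ne_zero⟩
  rw [← isRoot_cyclotomic_iff, aeval_def, ← eval_map, map_cyclotomic, IsRoot]

open Polynomial in
theorem stmt_17 (p q : ℕ) (hp : p.Prime) (hq : q.Prime) (hpodd : Odd p) (hqodd : Odd q)
    (hne : p ≠ q) (hdvd : p ∣ q - 1)
    (h2 : ¬ (2 ^ (q - 1) ≡ 1 [MOD q ^ 2])) :
    (q % 4 = 1 →
      ((X : (ZMod 2)[X]) ^ (p * q ^ 2) - 1) /
          EuclideanDomain.gcd ((X : (ZMod 2)[X]) ^ (p * q ^ 2) - 1)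
            (∑ t ∈ Finset.range (p * q ^ 2), C (binSeq p q t) * X ^ t) =
        cyclotomic (p * q ^ 2) (ZMod 2)) ∧
    (q % 4 = 3 →
      ((X : (ZMod 2)[X]) ^ (p * q ^ 2) - 1) /
          EuclideanDomain.gcd ((X : (ZMod 2)[X]) ^ (p * q ^ 2) - 1)
            (∑ t ∈ Finset.range (p * q ^ 2), C (binSeq p q t) * X ^ t) =
        cyclotomic (p * q ^ 2) (ZMod 2) * cyclotomic (p * q) (ZMod 2)) := by
  have hqf : Fact q.Prime := ⟨hq⟩
  let K := AlgebraicClosure (ZMod 2)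
  have hK : CharP K 2 := charP_of_injective_algebraMap (algebraMap (ZMod 2) K).injective 2
  have hq2 : Odd (q ^ 2) := hqodd.pow
  have hN : Odd (p * q ^ 2) := hpodd.mul hq2
  have hpq : p.Coprime (q ^ 2) := ((Nat.coprime_primes hp hq).mpr hne).pow_right 2
  have hsep : ((X : (ZMod 2)[X]) ^ (p * q ^ 2) - 1).Separable := by
    rw [X_pow_sub_one_separable_iff, natCast_eq_one_of_odd hN]
    exact one_ne_zero
  have hL1 : ∀ v : (ZMod (q ^ 2))ˣ, (v : ZMod (q ^ 2)) = 1 + q → reducedQuotient p q v ≠ 0 := by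
    intro v hv
    refine reducedQuotient_ne_zero hp hdvd ?_
    rw [fermatQuotient_of_val_eq_one_add hv]
    exact neg_ne_zero.mpr one_ne_zero
  have hL2 : ∀ v : (ZMod (q ^ 2))ˣ, (v : ZMod (q ^ 2)) = 2 → reducedQuotient p q v ≠ 0 := by
    intro v hv
    refine reducedQuotient_ne_zero hp hdvd ?_
    have hco : Nat.Coprime 2 (q ^ 2) := hq2.coprime_two_left
    have : v = ZMod.unitOfCoprime 2 hco := by
      ext
      simp [hv]
    rw [this]
    exact fermatQuotient_ne_zero hco h2
  have key : ∀ ζ η : K, ζ ^ p = 1 → η ^ q ^ 2 = 1 →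
      (aeval (ζ * η) (∑ t ∈ Finset.range (p * q ^ 2), C (binSeq p q t) * X ^ t : (ZMod 2)[X]) ≠ 0 ↔
        ζ ≠ 1 ∧ (IsPrimitiveRoot η (q ^ 2) ∨ (q % 4 = 3 ∧ IsPrimitiveRoot η q))) := by
    intro ζ η hζ hη
    simp only [map_sum, map_mul, aeval_C, map_pow, aeval_X]
    rw [sum_binSeq_mul_pow hp hne hdvd hζ hη, sum_pow_range_ne_zero_of_pow_eq_one hpodd hζ,
      mul_ne_zero_iff]
    refine and_congr (by split_ifs with h <;> simp [h]) ?_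
    by_cases hηq : η ^ q = 1
    · have hnot : ¬ IsPrimitiveRoot η (q ^ 2) := fun h =>
        h.pow_ne_one_of_pos_of_lt hq.ne_zero (by nlinarith [hq.two_le]) hηq
      rw [sum_upperHalf_mul_classSum_of_pow_eq_one hqodd reducedQuotient_mul hL1 hηq]
      by_cases h1 : η = 1
      · have : ¬ IsPrimitiveRoot η q := fun h => by
          rw [h1] at h
          exact hq.one_lt.ne' (h.unique IsPrimitiveRoot.one)
        simp [h1 ▸ hnot, h1 ▸ this, h1]
      · have hprim : IsPrimitiveRoot η q :=
          IsPrimitiveRoot.iff_orderOf.mpr (orderOf_eq_prime hηq h1)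
        have hpar : (((q - 1) / 2 : ℕ) : K) ≠ 0 ↔ q % 4 = 3 := by
          have := Nat.odd_iff.mp hqodd
          rw [Ne, CharP.cast_eq_zero_iff K 2]
          omega
        rw [if_neg h1, hpar]
        simp [hnot, hprim]
    · have hprim : IsPrimitiveRoot η (q ^ 2) := IsPrimitiveRoot.iff_orderOf.mpr
        (orderOf_eq_prime_pow (n := 1) (by rwa [pow_one]) hη)
      exact iff_of_true (sum_upperHalf_mul_classSum_ne_zero hqodd reducedQuotient_mul hL1 hL2 hprim)
        (Or.inl hprim)
  constructor
  · intro hq4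
    refine div_gcd_eq_of_roots K hsep (cyclotomic.dvd_X_pow_sub_one _ _) fun β hβ => ?_
    have hβ1 : β ^ (p * q ^ 2) = 1 := by simpa [sub_eq_zero] using hβ
    obtain ⟨ζ, η, hζ, hη, rfl⟩ := exists_mul_eq_of_pow_mul_eq_one hpq hβ1
    rw [key ζ η hζ hη, aeval_cyclotomic_eq_zero_iff hN,
      isPrimitiveRoot_mul_iff_of_prime hp hpq hζ hη]
    simp [hq4]
  · intro hq4
    have hM : cyclotomic (p * q ^ 2) (ZMod 2) * cyclotomic (p * q) (ZMod 2) ∣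
        (X : (ZMod 2)[X]) ^ (p * q ^ 2) - 1 := by
      have hmem : p * q ∈ (p * q ^ 2).properDivisors := by
        refine Nat.mem_properDivisors.mpr ⟨⟨q, by ring⟩, ?_⟩
        exact Nat.mul_lt_mul_of_pos_left (by nlinarith [hq.two_le]) hp.pos
      rw [mul_comm]
      exact (mul_dvd_mul_right (cyclotomic.dvd_X_pow_sub_one _ _) _).trans
        (X_pow_sub_one_mul_cyclotomic_dvd_X_pow_sub_one_of_dvd (ZMod 2) hmem)
    refine div_gcd_eq_of_roots K hsep hM fun β hβ => ?_
    have hβ1 : β ^ (p * q ^ 2) = 1 := by simpa [sub_eq_zero] using hβ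
    obtain ⟨ζ, η, hζ, hη, rfl⟩ := exists_mul_eq_of_pow_mul_eq_one hpq hβ1
    rw [key ζ η hζ hη, map_mul, mul_eq_zero, aeval_cyclotomic_eq_zero_iff hN,
      aeval_cyclotomic_eq_zero_iff (hpodd.mul hqodd),
      isPrimitiveRoot_mul_iff_of_prime hp hpq hζ hη,
      isPrimitiveRoot_mul_iff_of_prime hp hpq hζ hη]
    simp only [hq4, true_and]
    tauto
end

section
/- Let p and q be distinct odd primes with p dividing q − 1. The number of indices t with 0 ≤ t < pq² and s_t = 1 equals (p−1)(q−1)²/2; equivalently, the set of such t is the union of the (q−1)/2 pairwise disjoint sets D_{(q+1)/2}, ..., D_{q−1}, each of cardinality (p−1)(q−1). -/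
/-- If `a ^ n = b ^ n` and `a ^ k = b ^ k` modulo `m` for coprime exponents and `a`, `b` prime
to `m`, then `a` and `b` agree modulo `m`. -/
theorem modEq_of_pow_modEq_of_coprime {a b m n k : ℕ} (ha : a.Coprime m) (hb : b.Coprime m)
    (hnk : n.Coprime k) (hn : a ^ n ≡ b ^ n [MOD m]) (hk : a ^ k ≡ b ^ k [MOD m]) :
    a ≡ b [MOD m] := by
  have aux : ∀ j : ℕ, a ^ j ≡ b ^ j [MOD m] →
      (ZMod.unitOfCoprime a ha / ZMod.unitOfCoprime b hb) ^ j = 1 := by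
    intro j hj
    rw [div_pow, div_eq_one]
    ext
    simpa using (ZMod.natCast_eq_natCast_iff _ _ _).2 hj
  have h1 := pow_gcd_eq_one.2 ⟨aux n hn, aux k hk⟩
  rw [hnk.gcd_eq_one, pow_one, div_eq_one] at h1
  rw [← ZMod.natCast_eq_natCast_iff]
  simpa using congrArg Units.val h1

theorem pow_prime_modEq_sq {a b q : ℕ} (h : a ≡ b [MOD q]) : a ^ q ≡ b ^ q [MOD q ^ 2] := by
  have h1 : (q : ℤ) ∣ b - a := h.dvd
  have h2 := dvd_sub_pow_of_dvd_sub h1 1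
  rw [Nat.modEq_iff_dvd]
  push_cast
  simpa using h2

theorem prime_lt_of_dvd_sub_one {p q : ℕ} (hq : q.Prime) (hdvd : p ∣ q - 1) : p < q := by
  have := Nat.le_of_dvd (Nat.sub_pos_of_lt hq.one_lt) hdvd
  have := hq.one_lt
  omega

theorem sq_mul_dvd_pow_sub_one {p q t : ℕ} (hp : p.Prime) (hq : q.Prime) (hne : p ≠ q)
    (hdvd : p ∣ q - 1) (ht : t.Coprime (p * q)) :
    p ^ 2 * q ∣ t ^ ((p - 1) * (q - 1)) - 1 := by
  have aux : ∀ m, t.Coprime m → Nat.totient m ∣ (p - 1) * (q - 1) →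
      m ∣ t ^ ((p - 1) * (q - 1)) - 1 := by
    rintro m hm ⟨c, hc⟩
    refine (Nat.modEq_iff_dvd' ?_).1 ?_
    · rcases Nat.eq_zero_or_pos t with rfl | h0
      · rw [Nat.coprime_zero_left] at ht
        exact absurd (Nat.eq_one_of_mul_eq_one_right ht) hp.one_lt.ne'
      · exact Nat.one_le_pow _ _ h0
    · rw [hc, pow_mul]
      simpa using ((Nat.ModEq.pow_totient hm).pow c).symm
  refine Nat.Coprime.mul_dvd_of_dvd_of_dvd ?_ (aux _ ?_ ?_) (aux _ ?_ ?_)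
  · exact ((Nat.coprime_primes hp hq).2 hne).pow_left 2
  · exact ht.coprime_mul_right_right.pow_right 2
  · rw [Nat.totient_prime_pow hp two_pos, mul_comm]
    simpa using mul_dvd_mul_left (p - 1) hdvd
  · exact ht.coprime_mul_left_right
  · rw [Nat.totient_prime hq]
    exact dvd_mul_left _ _

/-- The Euler quotient determines the power `t ^ ((p - 1) * (q - 1))` modulo `(p * q) ^ 2`. -/
theorem pow_modEq_of_eulerQuotient {p q t : ℕ} (hp : p.Prime) (hq : q.Prime) (hne : p ≠ q)
    (hdvd : p ∣ q - 1) (ht : t.Coprime (p * q)) :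
    t ^ ((p - 1) * (q - 1)) ≡ p * q * eulerQuotient p q t + 1 [MOD p * q * (p * q)] := by
  have h1 : p * q ∣ t ^ ((p - 1) * (q - 1)) - 1 :=
    (mul_dvd_mul_right (dvd_pow_self p two_ne_zero) q).trans
      (sq_mul_dvd_pow_sub_one hp hq hne hdvd ht)
  have h0 : t ≠ 0 := by
    rintro rfl
    rw [Nat.coprime_zero_left] at ht
    exact absurd (Nat.eq_one_of_mul_eq_one_right ht) hp.one_lt.ne'
  have h2 : p * q * ((t ^ ((p - 1) * (q - 1)) - 1) / (p * q)) + 1 = t ^ ((p - 1) * (q - 1)) := by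
    rw [Nat.mul_div_cancel' h1]
    exact Nat.sub_add_cancel (Nat.one_le_pow _ _ (Nat.pos_of_ne_zero h0))
  rw [eulerQuotient, if_pos ht]
  conv_lhs => rw [← h2]
  exact (Nat.ModEq.mul_left' _ (Nat.mod_modEq _ _).symm).add_right 1

theorem eulerQuotient_lt {p q : ℕ} (hp : p.Prime) (hq : q.Prime) (t : ℕ) :
    eulerQuotient p q t < p * q := by
  have : 0 < p * q := Nat.mul_pos hp.pos hq.pos
  unfold eulerQuotient
  split_ifs
  · exact Nat.mod_lt _ this
  · exact this

theorem dvd_eulerQuotient {p q t : ℕ} (hp : p.Prime) (hq : q.Prime) (hne : p ≠ q)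
    (hdvd : p ∣ q - 1) (ht : t.Coprime (p * q)) : p ∣ eulerQuotient p q t := by
  rw [eulerQuotient, if_pos ht, Nat.dvd_mod_iff (dvd_mul_right p q)]
  refine Nat.dvd_div_of_mul_dvd ?_
  convert sq_mul_dvd_pow_sub_one hp hq hne hdvd ht using 1
  ring

theorem mem_Dset {p q ℓ t : ℕ} (hp : p.Prime) (hq : q.Prime) (hℓ : ℓ < q) :
    t ∈ Dset p q ℓ ↔ t < p * q ^ 2 ∧ t.Coprime (p * q) ∧ eulerQuotient p q t = p * ℓ := by
  have h : eulerQuotient p q t ≡ p * ℓ [MOD p * q] ↔ eulerQuotient p q t = p * ℓ :=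
    ⟨fun h => h.eq_of_lt_of_lt (eulerQuotient_lt hp hq t) (Nat.mul_lt_mul_of_pos_left hℓ hp.pos),
      fun h => h ▸ Nat.ModEq.refl _⟩
  simp [Dset, h, Nat.Coprime]

theorem disjoint_Dset {p q i j : ℕ} (hp : p.Prime) (hq : q.Prime) (hi : i < q) (hj : j < q)
    (hij : i ≠ j) : Disjoint (Dset p q i) (Dset p q j) := by
  rw [Finset.disjoint_left]
  intro t h1 h2
  rw [mem_Dset hp hq hi] at h1
  rw [mem_Dset hp hq hj] at h2
  exact hij (Nat.eq_of_mul_eq_mul_left hp.pos (h1.2.2.symm.trans h2.2.2))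

/-- Reduction modulo `p * q` is injective on `Dset p q ℓ`. -/
theorem card_Dset_le {p q ℓ : ℕ} (hp : p.Prime) (hq : q.Prime) (hne : p ≠ q)
    (hdvd : p ∣ q - 1) (hℓ : ℓ < q) : (Dset p q ℓ).card ≤ Nat.totient (p * q) := by
  rw [Nat.totient]
  refine Finset.card_le_card_of_injOn (· % (p * q)) ?_ ?_
  · intro t ht
    have ht' := ((mem_Dset hp hq hℓ).1 (Finset.mem_coe.1 ht)).2.1
    have hpq : 0 < p * q := Nat.mul_pos hp.pos hq.pos
    simp only [Finset.coe_filter, Finset.mem_range, Set.mem_ofPred_eq]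
    refine ⟨Nat.mod_lt _ hpq, ?_⟩
    rw [Nat.coprime_comm, Nat.Coprime, (Nat.mod_modEq t (p * q)).gcd_eq]
    exact ht'
  · intro a ha b hb hab
    obtain ⟨ha1, ha2, ha3⟩ := (mem_Dset hp hq hℓ).1 (Finset.mem_coe.1 ha)
    obtain ⟨hb1, hb2, hb3⟩ := (mem_Dset hp hq hℓ).1 (Finset.mem_coe.1 hb)
    have hab' : a ≡ b [MOD p * q] := hab
    have hpow : a ^ ((p - 1) * (q - 1)) ≡ b ^ ((p - 1) * (q - 1)) [MOD q ^ 2] := by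
      have h1 := pow_modEq_of_eulerQuotient hp hq hne hdvd ha2
      have h2 := pow_modEq_of_eulerQuotient hp hq hne hdvd hb2
      rw [ha3] at h1
      rw [hb3] at h2
      exact (h1.trans h2.symm).of_dvd ⟨p ^ 2, by ring⟩
    have hcop : Nat.Coprime ((p - 1) * (q - 1)) q := by
      have hpq := prime_lt_of_dvd_sub_one hq hdvd
      have hp1 := hp.one_lt
      exact Nat.Coprime.mul_left
        (Nat.coprime_of_lt_prime (by omega) (by omega) hq).symm
        (Nat.coprime_of_lt_prime (by omega) (by omega) hq).symm
    have hq2 : a ≡ b [MOD q ^ 2] :=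
      modEq_of_pow_modEq_of_coprime (ha2.coprime_mul_left_right.pow_right 2)
        (hb2.coprime_mul_left_right.pow_right 2) hcop hpow
        (pow_prime_modEq_sq (hab'.of_dvd (dvd_mul_left q p)))
    have hfin : a ≡ b [MOD p * q ^ 2] :=
      (Nat.modEq_and_modEq_iff_modEq_mul (((Nat.coprime_primes hp hq).2 hne).pow_right 2)).1
        ⟨hab'.of_dvd (dvd_mul_right p q), hq2⟩
    exact hfin.eq_of_lt_of_lt ha1 hb1

theorem biUnion_Dset {p q : ℕ} (hp : p.Prime) (hq : q.Prime) (hne : p ≠ q)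
    (hdvd : p ∣ q - 1) :
    (Finset.range q).biUnion (Dset p q) =
      (Finset.range (p * q ^ 2)).filter (fun t => (p * q ^ 2).Coprime t) := by
  have hco : ∀ t, (p * q ^ 2).Coprime t ↔ t.Coprime (p * q) := by
    intro t
    rw [Nat.coprime_comm, Nat.coprime_mul_iff_right, Nat.coprime_mul_iff_right,
      Nat.coprime_pow_right_iff two_pos]
  ext t
  simp only [Finset.mem_biUnion, Finset.mem_filter, Finset.mem_range, hco]
  constructor
  · rintro ⟨ℓ, hℓ, ht⟩
    rw [mem_Dset hp hq hℓ] at ht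
    exact ⟨ht.1, ht.2.1⟩
  · rintro ⟨h1, h2⟩
    obtain ⟨ℓ, hm⟩ := dvd_eulerQuotient hp hq hne hdvd h2
    have hℓ : ℓ < q := Nat.lt_of_mul_lt_mul_left (hm ▸ eulerQuotient_lt hp hq t)
    exact ⟨ℓ, hℓ, (mem_Dset hp hq hℓ).2 ⟨h1, h2, hm⟩⟩

theorem card_Dset {p q ℓ : ℕ} (hp : p.Prime) (hq : q.Prime) (hne : p ≠ q)
    (hdvd : p ∣ q - 1) (hℓ : ℓ < q) : (Dset p q ℓ).card = (p - 1) * (q - 1) := by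
  have hcop := (Nat.coprime_primes hp hq).2 hne
  have hφ : Nat.totient (p * q) = (p - 1) * (q - 1) := by
    rw [Nat.totient_mul hcop, Nat.totient_prime hp, Nat.totient_prime hq]
  have hsum : ∑ i ∈ Finset.range q, (Dset p q i).card =
      ∑ _i ∈ Finset.range q, Nat.totient (p * q) := by
    rw [← Finset.card_biUnion fun i hi j hj hij =>
      disjoint_Dset hp hq (Finset.mem_range.1 hi) (Finset.mem_range.1 hj) hij,
      biUnion_Dset hp hq hne hdvd, Finset.sum_const, Finset.card_range, smul_eq_mul, hφ]
    change Nat.totient (p * q ^ 2) = _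
    rw [Nat.totient_mul (hcop.pow_right 2), Nat.totient_prime hp,
      Nat.totient_prime_pow hq two_pos]
    ring
  rw [← hφ]
  exact (Finset.sum_eq_sum_iff_of_le fun i hi =>
    card_Dset_le hp hq hne hdvd (Finset.mem_range.1 hi)).1 hsum ℓ (Finset.mem_range.2 hℓ)

theorem binSeq_eq_one_iff {p q t : ℕ} : binSeq p q t = 1 ↔ p * q ≤ 2 * eulerQuotient p q t := by
  unfold binSeq
  split_ifs with h
  · simpa using h
  · simpa using h

theorem filter_binSeq_eq_biUnion {p q : ℕ} (hp : p.Prime) (hq : q.Prime) (hqodd : Odd q)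
    (hne : p ≠ q) (hdvd : p ∣ q - 1) :
    (Finset.range (p * q ^ 2)).filter (fun t => binSeq p q t = 1) =
      (Finset.Ico ((q + 1) / 2) q).biUnion (Dset p q) := by
  have hthr : ∀ m, p * q ≤ 2 * (p * m) ↔ (q + 1) / 2 ≤ m := by
    intro m
    rw [mul_left_comm, Nat.mul_le_mul_left_iff hp.pos]
    obtain ⟨k, rfl⟩ := hqodd
    omega
  ext t
  simp only [Finset.mem_filter, Finset.mem_range, binSeq_eq_one_iff, Finset.mem_biUnion,
    Finset.mem_Ico]
  constructor
  · rintro ⟨h1, h2⟩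
    have hco : t.Coprime (p * q) := by
      by_contra hco
      rw [eulerQuotient, if_neg hco] at h2
      have := Nat.mul_pos hp.pos hq.pos
      omega
    obtain ⟨m, hm⟩ := dvd_eulerQuotient hp hq hne hdvd hco
    have hmq : m < q := Nat.lt_of_mul_lt_mul_left (hm ▸ eulerQuotient_lt hp hq t)
    rw [hm, hthr] at h2
    exact ⟨m, ⟨h2, hmq⟩, (mem_Dset hp hq hmq).2 ⟨h1, hco, hm⟩⟩
  · rintro ⟨m, ⟨hm, hmq⟩, ht⟩
    rw [mem_Dset hp hq hmq] at ht
    exact ⟨ht.1, by rw [ht.2.2, hthr]; exact hm⟩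

theorem stmt_19 (p q : ℕ) (hp : p.Prime) (hq : q.Prime) (hpodd : Odd p) (hqodd : Odd q)
    (hne : p ≠ q) (hdvd : p ∣ q - 1) :
    ((Finset.range (p * q ^ 2)).filter (fun t => binSeq p q t = 1)).card =
        (p - 1) * (q - 1) ^ 2 / 2 ∧
    (Finset.range (p * q ^ 2)).filter (fun t => binSeq p q t = 1) =
        (Finset.Ico ((q + 1) / 2) q).biUnion (Dset p q) ∧
    (∀ i ∈ Finset.Ico ((q + 1) / 2) q, ∀ j ∈ Finset.Ico ((q + 1) / 2) q, i ≠ j →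
        Disjoint (Dset p q i) (Dset p q j)) ∧
    (∀ ℓ ∈ Finset.Ico ((q + 1) / 2) q, (Dset p q ℓ).card = (p - 1) * (q - 1)) := by
  have hlt : ∀ i ∈ Finset.Ico ((q + 1) / 2) q, i < q := fun i hi => (Finset.mem_Ico.1 hi).2
  have hU := filter_binSeq_eq_biUnion hp hq hqodd hne hdvd
  have hD : ∀ i ∈ Finset.Ico ((q + 1) / 2) q, ∀ j ∈ Finset.Ico ((q + 1) / 2) q, i ≠ j →
      Disjoint (Dset p q i) (Dset p q j) :=
    fun i hi j hj hij => disjoint_Dset hp hq (hlt i hi) (hlt j hj) hij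
  have hC : ∀ ℓ ∈ Finset.Ico ((q + 1) / 2) q, (Dset p q ℓ).card = (p - 1) * (q - 1) :=
    fun ℓ hℓ => card_Dset hp hq hne hdvd (hlt ℓ hℓ)
  refine ⟨?_, hU, hD, hC⟩
  rw [hU, Finset.card_biUnion hD, Finset.sum_congr rfl hC, Finset.sum_const, Nat.card_Ico,
    smul_eq_mul]
  obtain ⟨k, rfl⟩ := hqodd
  have h1 : 2 * k + 1 - (2 * k + 1 + 1) / 2 = k := by omega
  rw [h1, Nat.add_sub_cancel]
  refine (Nat.div_eq_of_eq_mul_left two_pos ?_).symm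
  ring
end
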